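/- arXiv:2603.19611 — 9 statements merged into one kernel-verified Lean document; each statement's English description precedes it below -/
import Mathlib

section
/- Let J ⊆ ℝ be a bounded closed interval with positive length and let E ⊆ J be a Lebesgue-measurable set with positive Lebesgue measure. Then for every real polynomial p of degree at most n, sup_{x ∈ J} |p(x)| ≤ (4·mes(J)/mes(E))^n · sup_{x ∈ E} |p(x)|. -/
open MeasureTheory

/-- The inverse products of distances between Chebyshev nodes add up to the leading coefficient
of the Chebyshev polynomial. -/
lemma sum_inv_prod_abs_node_sub_node (n : ℕ) :
    ∑ i ∈ Finset.range (n + 1), (∏ j ∈ (Finset.range (n + 1)).erase i,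
      |Polynomial.Chebyshev.node n i - Polynomial.Chebyshev.node n j|)⁻¹ = 2 ^ (n - 1) := by
  open Polynomial.Chebyshev in
  have hcoeff : (T ℝ n).coeff n = 2 ^ (n - 1) := by
    have h := leadingCoeff_T (R := ℝ) (n : ℤ)
    rw [Polynomial.leadingCoeff, natDegree_T] at h
    simpa using h
  have hlt : (T ℝ n).degree < (Finset.range (n + 1)).card := by
    rw [degree_T, Finset.card_range, Int.natAbs_natCast]
    exact_mod_cast n.lt_succ_self
  have hsum := Lagrange.coeff_eq_sum (strictAntiOn_node n).injOn hlt
  rw [Finset.card_range, Nat.add_sub_cancel, hcoeff] at hsum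
  rw [hsum]
  refine Finset.sum_congr rfl fun i hi => ?_
  have hi' : i ≤ n := Finset.mem_range_succ_iff.mp hi
  have hpos := zero_lt_prod_node_sub_node hi'
  rw [eval_T_real_node (Finset.mem_Iic.mpr hi'), ← Finset.abs_prod]
  rcases neg_one_pow_eq_or ℝ i with h | h <;> rw [h] at hpos ⊢
  · rw [abs_of_pos (by linarith), one_div]
  · rw [abs_of_neg (by linarith), inv_neg, neg_div, one_div]

/-- The measure of the part of `K` to the left of a point is `1`-Lipschitz. -/
lemma lipschitzWith_measureReal_inter_Iic {K : Set ℝ} (hK : volume K ≠ ⊤) :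
    LipschitzWith 1 fun y : ℝ => volume.real (K ∩ Set.Iic y) := by
  refine LipschitzWith.of_le_add fun x y => ?_
  have hfin (z : ℝ) : volume (K ∩ Set.Iic z) ≠ ⊤ :=
    measure_ne_top_of_subset Set.inter_subset_left hK
  have hsub : K ∩ Set.Iic x ⊆ (K ∩ Set.Iic y) ∪ Set.Ioc y x := fun z hz => by
    rcases le_or_gt z y with h | h
    · exact Or.inl ⟨hz.1, h⟩
    · exact Or.inr ⟨h, hz.2⟩
  calc volume.real (K ∩ Set.Iic x)
      ≤ volume.real ((K ∩ Set.Iic y) ∪ Set.Ioc y x) :=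
        measureReal_mono hsub (measure_union_ne_top (hfin y) measure_Ioc_lt_top.ne)
    _ ≤ volume.real (K ∩ Set.Iic y) + volume.real (Set.Ioc y x) := measureReal_union_le _ _
    _ ≤ volume.real (K ∩ Set.Iic y) + dist x y := by
        gcongr
        rw [Real.volume_real_Ioc, Real.dist_eq]
        exact max_le (le_abs_self _) (abs_nonneg _)

/-- Every value between `0` and the measure of a nonempty compact set `K` is the measure of the
part of `K` to the left of some point of `K`. -/
lemma exists_mem_measureReal_inter_Iic_eq {K : Set ℝ} (hK : IsCompact K) (hne : K.Nonempty)
    {t : ℝ} (ht : t ∈ Set.Icc 0 (volume.real K)) :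
    ∃ y ∈ K, volume.real (K ∩ Set.Iic y) = t := by
  have hfin (z : ℝ) : volume (K ∩ Set.Iic z) ≠ ⊤ :=
    measure_ne_top_of_subset Set.inter_subset_left hK.measure_ne_top
  obtain ⟨c, -, hc⟩ := hK.exists_isLeast hne
  obtain ⟨d, hdK, hd⟩ := hK.exists_isGreatest hne
  have hGc : volume.real (K ∩ Set.Iic c) = 0 := by
    have hsub : K ∩ Set.Iic c ⊆ {c} := fun z hz => le_antisymm hz.2 (hc hz.1)
    simp [measureReal_def, measure_mono_null hsub (Real.volume_singleton)]
  have hGd : volume.real (K ∩ Set.Iic d) = volume.real K := by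
    rw [Set.inter_eq_left.mpr (show K ⊆ Set.Iic d from fun z hz => hd hz)]
  obtain ⟨y, -, hy⟩ := intermediate_value_Icc (hc hdK)
    (lipschitzWith_measureReal_inter_Iic hK.measure_ne_top).continuous.continuousOn
    (by rwa [hGc, hGd])
  rcases le_or_gt d y with hdy | hyd
  · refine ⟨d, hdK, ?_⟩
    have hKy : K ⊆ Set.Iic y := fun z hz => (hd hz).trans hdy
    simpa [hGd, Set.inter_eq_left.mpr hKy] using hy
  · obtain ⟨z, ⟨hzK, hyz⟩, hz⟩ := (hK.inter_right isClosed_Ici).exists_isLeast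
      (⟨d, hdK, hyd.le⟩ : (K ∩ Set.Ici y).Nonempty)
    refine ⟨z, hzK, le_antisymm ?_ ?_⟩
    · have hsub : K ∩ Set.Iic z ⊆ (K ∩ Set.Iic y) ∪ {z} := fun w hw => by
        rcases le_or_gt w y with h | h
        · exact Or.inl ⟨hw.1, h⟩
        · exact Or.inr (le_antisymm hw.2 (hz ⟨hw.1, h.le⟩))
      calc volume.real (K ∩ Set.Iic z)
          ≤ volume.real ((K ∩ Set.Iic y) ∪ {z}) :=
            measureReal_mono hsub (measure_union_ne_top (hfin y) (by simp))
        _ ≤ volume.real (K ∩ Set.Iic y) + volume.real {z} := measureReal_union_le _ _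
        _ = t := by simp [measureReal_def, ← hy]
    · rw [← hy]
      exact measureReal_mono (Set.inter_subset_inter_right _ (Set.Iic_subset_Iic.mpr hyz)) (hfin z)

/-- Lagrange interpolation at points which are spread out at least as much as the Chebyshev nodes,
rescaled to an interval of length `m`. -/
lemma abs_eval_le_of_node_spread {n : ℕ} {p : Polynomial ℝ} (hdeg : p.natDegree ≤ n)
    {m L M x : ℝ} (hm : 0 < m) {v : ℕ → ℝ}
    (hv : ∀ i ≤ n, ∀ j ≤ n, m / 2 *
      |Polynomial.Chebyshev.node n i - Polynomial.Chebyshev.node n j| ≤ |v i - v j|)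
    (hx : ∀ i ≤ n, |x - v i| ≤ L) (hM : ∀ i ≤ n, |p.eval (v i)| ≤ M) :
    |p.eval x| ≤ (4 * L / m) ^ n * M := by
  open Polynomial.Chebyshev in
  have hL : 0 ≤ L := (abs_nonneg _).trans (hx 0 n.zero_le)
  have hM0 : 0 ≤ M := (abs_nonneg _).trans (hM 0 n.zero_le)
  have hnode {i j : ℕ} (hi : i ≤ n) (hj : j ≤ n) (hij : i ≠ j) : 0 < |node n i - node n j| :=
    abs_pos.mpr <| sub_ne_zero.mpr fun h => hij <| (strictAntiOn_node n).injOn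
      (by simpa [Nat.lt_succ_iff] using hi) (by simpa [Nat.lt_succ_iff] using hj) h
  have hinj : Set.InjOn v (Finset.range (n + 1)) := fun i hi j hj hij => by
    by_contra hne
    have hi' : i ≤ n := by simpa [Nat.lt_succ_iff] using hi
    have hj' : j ≤ n := by simpa [Nat.lt_succ_iff] using hj
    have h := hv i hi' j hj'
    rw [hij, sub_self, abs_zero] at h
    nlinarith [mul_pos (half_pos hm) (hnode hi' hj' hne)]
  have hlt : p.degree < (Finset.range (n + 1)).card := by
    rw [Finset.card_range]
    exact (Polynomial.degree_le_of_natDegree_le hdeg).trans_lt (by exact_mod_cast n.lt_succ_self)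
  have hterm : ∀ i ∈ Finset.range (n + 1),
      |p.eval (v i) * (Lagrange.basis (Finset.range (n + 1)) v i).eval x| ≤
        M * ((2 * L / m) ^ n *
          (∏ j ∈ (Finset.range (n + 1)).erase i, |node n i - node n j|)⁻¹) := by
    intro i hi
    have hi' : i ≤ n := Finset.mem_range_succ_iff.mp hi
    rw [abs_mul]
    refine mul_le_mul (hM i hi') ?_ (abs_nonneg _) hM0
    have hcard : ((Finset.range (n + 1)).erase i).card = n := by
      rw [Finset.card_erase_of_mem hi, Finset.card_range, Nat.add_sub_cancel]
    rw [Lagrange.basis, Polynomial.eval_prod, Finset.abs_prod, ← Finset.prod_inv_distrib]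
    nth_rewrite 2 [← hcard]
    rw [← Finset.prod_const, ← Finset.prod_mul_distrib]
    refine Finset.prod_le_prod (fun _ _ => abs_nonneg _) fun j hj => ?_
    obtain ⟨hji, hj⟩ := Finset.mem_erase.mp hj
    have hj' : j ≤ n := Finset.mem_range_succ_iff.mp hj
    have hpos := hnode hi' hj' hji.symm
    calc |(Lagrange.basisDivisor (v i) (v j)).eval x|
        = |v i - v j|⁻¹ * |x - v j| := by
          simp [Lagrange.basisDivisor, abs_mul, abs_inv]
      _ ≤ (m / 2 * |node n i - node n j|)⁻¹ * L := by
          gcongr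
          · exact hv i hi' j hj'
          · exact hx j hj'
      _ = 2 * L / m * |node n i - node n j|⁻¹ := by field_simp
  calc |p.eval x|
      = |∑ i ∈ Finset.range (n + 1),
          p.eval (v i) * (Lagrange.basis (Finset.range (n + 1)) v i).eval x| := by
        conv_lhs => rw [Lagrange.eq_interpolate hinj hlt, Lagrange.interpolate_apply,
          Polynomial.eval_finsetSum]
        simp
    _ ≤ ∑ i ∈ Finset.range (n + 1), M * ((2 * L / m) ^ n *
          (∏ j ∈ (Finset.range (n + 1)).erase i, |node n i - node n j|)⁻¹) :=
        (Finset.abs_sum_le_sum_abs _ _).trans (Finset.sum_le_sum hterm)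
    _ = M * ((2 * L / m) ^ n * 2 ^ (n - 1)) := by
        rw [← Finset.mul_sum, ← Finset.mul_sum, sum_inv_prod_abs_node_sub_node]
    _ ≤ M * ((2 * L / m) ^ n * 2 ^ n) := by
        gcongr
        · norm_num
        · exact n.sub_le 1
    _ = (4 * L / m) ^ n * M := by
        rw [← mul_pow, mul_comm]
        congr 2
        ring

/-- **Remez inequality for polynomials.** If `J = [a,b]` is a bounded closed interval with
positive length and `E ⊆ J` is measurable with positive Lebesgue measure, then for any real
polynomial `p` of degree at most `n`,
`sup_{x ∈ J} |p(x)| ≤ (4 · mes(J) / mes(E))^n · sup_{x ∈ E} |p(x)|`. -/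
theorem remez_inequality (a b : ℝ) (hab : a < b) (E : Set ℝ)
    (hEmeas : MeasurableSet E) (hEJ : E ⊆ Set.Icc a b)
    (hEpos : 0 < volume E) (n : ℕ) (p : Polynomial ℝ) (hdeg : p.natDegree ≤ n) :
    ∀ x ∈ Set.Icc a b,
      |p.eval x| ≤ (4 * (volume (Set.Icc a b)).toReal / (volume E).toReal) ^ n *
        ⨆ y : E, |p.eval (y : ℝ)| := by
  intro x hx
  have hKJ : closure E ⊆ Set.Icc a b := closure_minimal hEJ isClosed_Icc
  have hK : IsCompact (closure E) := isCompact_Icc.of_isClosed_subset isClosed_closure hKJ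
  have hne : (closure E).Nonempty := (nonempty_of_measure_ne_zero hEpos.ne').closure
  have hcont : Continuous fun y : ℝ => |p.eval y| := p.continuous.abs
  have hbdd : BddAbove (Set.range fun y : E => |p.eval (y : ℝ)|) := by
    refine (isCompact_Icc.bddAbove_image (K := Set.Icc a b) hcont.continuousOn).mono ?_
    rintro _ ⟨y, rfl⟩
    exact ⟨y, hEJ y.2, rfl⟩
  have hM : ∀ y ∈ closure E, |p.eval y| ≤ ⨆ y : E, |p.eval (y : ℝ)| :=
    closure_minimal (fun y hy => le_ciSup hbdd ⟨y, hy⟩) (isClosed_le hcont continuous_const)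
  have hEtop : volume E ≠ ⊤ := measure_ne_top_of_subset hEJ measure_Icc_lt_top.ne
  have hm : 0 < (volume E).toReal := ENNReal.toReal_pos hEpos.ne' hEtop
  have hmK : (volume E).toReal ≤ volume.real (closure E) :=
    measureReal_mono subset_closure hK.measure_ne_top
  have hpts : ∀ i : ℕ, ∃ y ∈ closure E, volume.real (closure E ∩ Set.Iic y) =
      (volume E).toReal / 2 * (1 + Polynomial.Chebyshev.node n i) := fun i => by
    obtain ⟨h1, h2⟩ := Polynomial.Chebyshev.node_mem_Icc (n := n) (i := i)
    exact exists_mem_measureReal_inter_Iic_eq hK hne ⟨by nlinarith, by nlinarith⟩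
  choose v hvK hv using hpts
  refine abs_eval_le_of_node_spread hdeg hm (v := v) (fun i _ j _ => ?_) (fun i _ => ?_)
    fun i _ => hM _ (hvK i)
  · have h := (lipschitzWith_measureReal_inter_Iic hK.measure_ne_top).dist_le_mul (v i) (v j)
    simp only [hv, Real.dist_eq, NNReal.coe_one, one_mul] at h
    rwa [← mul_sub, add_sub_add_left_eq_sub, abs_mul, abs_of_pos (half_pos hm)] at h
  · rw [Real.volume_Icc, ENNReal.toReal_ofReal (sub_nonneg.mpr hab.le)]
    have hvJ := hKJ (hvK i)
    exact abs_le.mpr ⟨by linarith [hx.1, hvJ.2], by linarith [hx.2, hvJ.1]⟩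
end

section
/- Let f : [0,1] → ℝ be Lipschitz continuous with Lipschitz constant L. For n ≥ 1, let B_n f denote the degree-n Bernstein polynomial of f, B_n f(t) = Σ_{k=0}^{n} f(k/n) · C(n,k) · t^k (1−t)^{n−k}. Then sup_{t ∈ [0,1]} |B_n f(t) − f(t)| ≤ L/(2√n). -/
open Finset

/-- The Bernstein weights at a point sum to one. -/
theorem sum_bernstein_weights (n : ℕ) (t : ℝ) :
    ∑ k ∈ Finset.range (n + 1), (n.choose k : ℝ) * t ^ k * (1 - t) ^ (n - k) = 1 := by
  have h := congrArg (Polynomial.eval t) (bernsteinPolynomial.sum ℝ n)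
  simpa [bernsteinPolynomial, Polynomial.eval_finsetSum] using h

/-- The variance of the Bernstein weights at a point. -/
theorem sum_sq_mul_bernstein_weights {n : ℕ} (hn : n ≠ 0) (t : ℝ) :
    ∑ k ∈ Finset.range (n + 1),
      ((k : ℝ) / n - t) ^ 2 * ((n.choose k : ℝ) * t ^ k * (1 - t) ^ (n - k)) =
        t * (1 - t) / n := by
  have hn' : (n : ℝ) ≠ 0 := Nat.cast_ne_zero.mpr hn
  have h := congrArg (Polynomial.eval t) (bernsteinPolynomial.variance ℝ n)
  simp only [bernsteinPolynomial, Polynomial.eval_finsetSum, nsmul_eq_mul, Polynomial.eval_mul,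
    Polynomial.eval_pow, Polynomial.eval_sub, Polynomial.eval_natCast, Polynomial.eval_X,
    Polynomial.eval_one] at h
  calc
    _ = (∑ k ∈ Finset.range (n + 1),
          (n * t - k) ^ 2 * ((n.choose k : ℝ) * t ^ k * (1 - t) ^ (n - k))) / (n : ℝ) ^ 2 := by
      rw [Finset.sum_div]
      refine Finset.sum_congr rfl fun k _ => ?_
      field_simp
      ring
    _ = t * (1 - t) / n := by
      rw [h]
      field_simp

/-- **Bernstein approximation theorem, Lipschitz case.** If `f : [0,1] → ℝ` is Lipschitz with
constant `L` and `n ≥ 1`, then the degree-`n` Bernstein polynomial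
`B_n f(t) = Σ_{k=0}^{n} f(k/n) · C(n,k) · t^k (1−t)^{n−k}` satisfies
`sup_{t ∈ [0,1]} |B_n f(t) − f(t)| ≤ L / (2√n)`. -/
theorem bernstein_lipschitz (f : ℝ → ℝ) (L : ℝ)
    (hf : ∀ s ∈ Set.Icc (0:ℝ) 1, ∀ t ∈ Set.Icc (0:ℝ) 1, |f s - f t| ≤ L * |s - t|)
    (n : ℕ) (hn : 1 ≤ n) :
    ∀ t ∈ Set.Icc (0:ℝ) 1,
      |(∑ k ∈ Finset.range (n + 1),
          f ((k : ℝ) / n) * (n.choose k : ℝ) * t ^ k * (1 - t) ^ (n - k)) - f t|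
        ≤ L / (2 * Real.sqrt n) := by
  intro t ht
  have hL : 0 ≤ L := by
    have h := (abs_nonneg _).trans (hf 1 (by simp) 0 (by simp))
    simpa using h
  have hn0 : (0 : ℝ) < n := by exact_mod_cast hn
  set r := Real.sqrt n
  have hr : 0 < r := Real.sqrt_pos.mpr hn0
  have hrn : (n : ℝ) = r ^ 2 := (Real.sq_sqrt hn0.le).symm
  have h_abs (x : ℝ) : |x| ≤ r * x ^ 2 + 1 / (4 * r) := by
    have h : r * x ^ 2 + 1 / (4 * r) - |x| = (2 * r * |x| - 1) ^ 2 / (4 * r) := by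
      rw [← sq_abs x]
      field_simp
      ring
    have : 0 ≤ (2 * r * |x| - 1) ^ 2 / (4 * r) := by positivity
    linarith
  let w (k : ℕ) : ℝ := (n.choose k : ℝ) * t ^ k * (1 - t) ^ (n - k)
  have hw (k : ℕ) : 0 ≤ w k := by
    have h₀ := ht.1
    have h₁ : 0 ≤ 1 - t := sub_nonneg.mpr ht.2
    positivity
  have h_one : ∑ k ∈ Finset.range (n + 1), w k = 1 := sum_bernstein_weights n t
  have h_var : ∑ k ∈ Finset.range (n + 1), ((k : ℝ) / n - t) ^ 2 * w k = t * (1 - t) / n :=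
    sum_sq_mul_bernstein_weights (by lia) t
  calc
    _ = |∑ k ∈ Finset.range (n + 1), (f ((k : ℝ) / n) - f t) * w k| := by
      simp only [sub_mul, Finset.sum_sub_distrib, ← Finset.mul_sum, h_one, mul_one]
      simp only [w, mul_assoc]
    _ ≤ ∑ k ∈ Finset.range (n + 1), |(f ((k : ℝ) / n) - f t) * w k| :=
      Finset.abs_sum_le_sum_abs _ _
    _ ≤ ∑ k ∈ Finset.range (n + 1),
          L * (r * (((k : ℝ) / n - t) ^ 2 * w k) + 1 / (4 * r) * w k) := by
      refine Finset.sum_le_sum fun k hk => ?_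
      have hk' : (k : ℝ) ≤ n := by exact_mod_cast Nat.lt_succ_iff.mp (Finset.mem_range.mp hk)
      have hmem : (k : ℝ) / n ∈ Set.Icc (0 : ℝ) 1 := ⟨by positivity, div_le_one_of_le₀ hk' hn0.le⟩
      rw [abs_mul, abs_of_nonneg (hw k)]
      calc
        _ ≤ L * (r * ((k : ℝ) / n - t) ^ 2 + 1 / (4 * r)) * w k :=
          mul_le_mul_of_nonneg_right
            ((hf _ hmem t ht).trans (mul_le_mul_of_nonneg_left (h_abs _) hL)) (hw k)
        _ = _ := by ring
    _ = L * (r * (t * (1 - t) / n) + 1 / (4 * r)) := by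
      rw [← Finset.mul_sum, Finset.sum_add_distrib, ← Finset.mul_sum, ← Finset.mul_sum, h_var,
        h_one, mul_one]
    _ ≤ L * (r * (1 / 4 / n) + 1 / (4 * r)) := by
      gcongr
      nlinarith [sq_nonneg (2 * t - 1)]
    _ = L / (2 * r) := by
      rw [hrn]
      field_simp
      ring
end

section
/- Let V be a real normed vector space, let D₀ ⊆ V, and let z, z' ∈ V. Define the path γ : [0,1] → V by γ(t) = z' + t(z − z'). Let f : V → ℝ be nonnegative and Lipschitz with constant L₀ on a set containing the segment γ([0,1]). Suppose the set E = {t ∈ [0,1] : γ(t) ∈ D₀} is Lebesgue-measurable with mes(E) > 0. Let l = L₀·‖z − z'‖, let A = 4/mes(E), and suppose S ∈ ℝ satisfies f(w) ≤ S for all w ∈ D₀. Then for every integer n ≥ 1, f(z) ≤ A^n · S + (1 + A^n) · l/(2√n). -/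
open MeasureTheory

/-- **ICL generalization bound (Lipschitz form).** Let `f : V → ℝ` be nonnegative and Lipschitz
with constant `L₀` on a set containing the segment `γ([0,1])`, where `γ(t) = z' + t(z − z')`.
If `E = {t ∈ [0,1] : γ(t) ∈ D₀}` is measurable with positive measure, `l = L₀‖z − z'‖`,
`A = 4 / mes(E)`, and `f ≤ S` on `D₀`, then for every `n ≥ 1`,
`f(z) ≤ Aⁿ·S + (1 + Aⁿ)·l/(2√n)`. -/
theorem icl_generalization_bound {V : Type*} [NormedAddCommGroup V] [NormedSpace ℝ V]
    (D₀ : Set V) (z z' : V) (γ : ℝ → V) (hγ : ∀ t : ℝ, γ t = z' + t • (z - z'))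
    (f : V → ℝ) (hf0 : ∀ w, 0 ≤ f w)
    (K : Set V) (hK : γ '' Set.Icc (0:ℝ) 1 ⊆ K) (L₀ : ℝ)
    (hlip : ∀ a ∈ K, ∀ b ∈ K, |f a - f b| ≤ L₀ * ‖a - b‖)
    (E : Set ℝ) (hEdef : E = {t : ℝ | t ∈ Set.Icc (0:ℝ) 1 ∧ γ t ∈ D₀})
    (hEmeas : MeasurableSet E) (hEpos : 0 < volume E)
    (l A : ℝ) (hl : l = L₀ * ‖z - z'‖) (hA : A = 4 / (volume E).toReal)
    (S : ℝ) (hS : ∀ w ∈ D₀, f w ≤ S)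
    (n : ℕ) (hn : 1 ≤ n) :
    f z ≤ A ^ n * S + (1 + A ^ n) * l / (2 * Real.sqrt n) := by
  obtain ⟨t, ht⟩ : E.Nonempty := nonempty_of_measure_ne_zero hEpos.ne'
  have hE : E ⊆ Set.Icc 0 1 := by
    rw [hEdef]
    exact fun _ h => h.1
  have htI := hE ht
  have htD : γ t ∈ D₀ := by
    rw [hEdef] at ht
    exact ht.2
  have hz : γ 1 = z := by simp [hγ]
  have hz' : γ 0 = z' := by simp [hγ]
  have hmem : ∀ s ∈ Set.Icc (0 : ℝ) 1, γ s ∈ K := fun s hs => hK ⟨s, hs, rfl⟩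
  have hzK : z ∈ K := hz ▸ hmem 1 (by simp)
  have hz'K : z' ∈ K := hz' ▸ hmem 0 (by simp)
  have hl0 : 0 ≤ l := hl ▸ (abs_nonneg _).trans (hlip z hzK z' hz'K)
  have hS0 : 0 ≤ S := (hf0 _).trans (hS _ htD)
  have hdist : ‖z - γ t‖ = (1 - t) * ‖z - z'‖ := by
    have h : z - γ t = (1 - t) • (z - z') := by
      rw [hγ]
      module
    rw [h, norm_smul, Real.norm_of_nonneg (sub_nonneg.2 htI.2)]
  have hfz : f z ≤ S + l := by
    have h := (le_abs_self _).trans (hlip z hzK _ (hmem t htI))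
    have h' : L₀ * ‖z - γ t‖ = (1 - t) * l := by
      rw [hdist, hl]
      ring
    nlinarith [hS _ htD, mul_nonneg htI.1 hl0]
  have hvol : volume E ≤ 1 := by simpa using measure_mono (μ := volume) hE
  have hm0 : 0 < (volume E).toReal :=
    ENNReal.toReal_pos hEpos.ne' (hvol.trans_lt ENNReal.one_lt_top).ne
  have hm1 : (volume E).toReal ≤ 1 := by
    simpa using ENNReal.toReal_mono ENNReal.one_ne_top hvol
  have hA4 : 4 ≤ A := by
    rw [hA, le_div_iff₀ hm0]
    linarith
  have hAn : 1 + (n : ℝ) * 3 ≤ A ^ n :=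
    (one_add_mul_le_pow (by norm_num) n).trans
      (pow_le_pow_left₀ (by norm_num) (by linarith) n)
  have hn1 : (1 : ℝ) ≤ n := by exact_mod_cast hn
  have hsqrt : 1 ≤ Real.sqrt n := Real.one_le_sqrt.2 hn1
  have hsqrt_le : Real.sqrt n ≤ n := Real.sqrt_le_iff.2 ⟨by linarith, by nlinarith⟩
  have hSA : S ≤ A ^ n * S := le_mul_of_one_le_left hS0 (by linarith)
  have hlA : l ≤ (1 + A ^ n) * l / (2 * Real.sqrt n) := by
    rw [le_div_iff₀ (by positivity), mul_comm l]
    exact mul_le_mul_of_nonneg_right (by linarith) hl0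
  linarith
end

section
/- Under the hypotheses of the ICL generalization bound (V a real normed space, D₀ ⊆ V, z, z' ∈ V, γ(t) = z' + t(z − z'), f : V → ℝ nonnegative and Lipschitz with constant L₀ on a set containing γ([0,1]), E = {t ∈ [0,1] : γ(t) ∈ D₀} measurable with mes(E) > 0, l = L₀·‖z − z'‖, A = 4/mes(E), and f(w) ≤ S for all w ∈ D₀), taking n = ⌈l²⌉ (assuming l > 0) yields f(z) ≤ A^{⌈l²⌉} · S + (1 + A^{⌈l²⌉})/2. -/
open MeasureTheory

/-- **ICL generalization bound, specialized degree.** Under the hypotheses of the ICL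
generalization bound, taking `n = ⌈l²⌉` (for `l > 0`) and using `l/√⌈l²⌉ ≤ 1` gives
`f(z) ≤ A^⌈l²⌉·S + (1 + A^⌈l²⌉)/2`. -/
theorem icl_generalization_bound_ceil {V : Type*} [NormedAddCommGroup V] [NormedSpace ℝ V]
    (D₀ : Set V) (z z' : V) (γ : ℝ → V) (hγ : ∀ t : ℝ, γ t = z' + t • (z - z'))
    (f : V → ℝ) (hf0 : ∀ w, 0 ≤ f w)
    (K : Set V) (hK : γ '' Set.Icc (0:ℝ) 1 ⊆ K) (L₀ : ℝ)
    (hlip : ∀ a ∈ K, ∀ b ∈ K, |f a - f b| ≤ L₀ * ‖a - b‖)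
    (E : Set ℝ) (hEdef : E = {t : ℝ | t ∈ Set.Icc (0:ℝ) 1 ∧ γ t ∈ D₀})
    (hEmeas : MeasurableSet E) (hEpos : 0 < volume E)
    (l A : ℝ) (hl : l = L₀ * ‖z - z'‖) (hA : A = 4 / (volume E).toReal)
    (hlpos : 0 < l)
    (S : ℝ) (hS : ∀ w ∈ D₀, f w ≤ S) :
    f z ≤ A ^ (⌈l ^ 2⌉₊) * S + (1 + A ^ (⌈l ^ 2⌉₊)) / 2 := by
  have hEsub : E ⊆ Set.Icc (0:ℝ) 1 := by
    rw [hEdef]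
    exact fun t ht => ht.1
  have hvol : volume E ≤ 1 := by
    simpa using measure_mono (μ := volume) hEsub
  have hm0 : 0 < (volume E).toReal :=
    ENNReal.toReal_pos hEpos.ne' (ne_top_of_le_ne_top ENNReal.one_ne_top hvol)
  have hm1 : (volume E).toReal ≤ 1 := by
    simpa using ENNReal.toReal_mono ENNReal.one_ne_top hvol
  have hA4 : 4 ≤ A := by
    rw [hA, le_div_iff₀ hm0]
    linarith
  obtain ⟨t, htE⟩ := nonempty_of_measure_ne_zero hEpos.ne'
  have ht : t ∈ Set.Icc (0:ℝ) 1 ∧ γ t ∈ D₀ := by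
    rw [hEdef] at htE
    exact htE
  have hγ1 : γ 1 = z := by simp [hγ]
  have hdist : ‖z - γ t‖ = (1 - t) * ‖z - z'‖ := by
    have h : z - γ t = (1 - t) • (z - z') := by
      rw [hγ]
      module
    rw [h, norm_smul, Real.norm_of_nonneg (by linarith [ht.1.2])]
  have hzK : z ∈ K := hK ⟨1, by simp, hγ1⟩
  have hfz : f z ≤ S + l := by
    have h₁ := (le_abs_self _).trans (hlip z hzK (γ t) (hK ⟨t, ht.1, rfl⟩))
    have h₂ : L₀ * ‖z - γ t‖ = (1 - t) * l := by
      rw [hdist, hl]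
      ring
    nlinarith [hS _ ht.2, mul_nonneg ht.1.1 hlpos.le]
  have hS0 : 0 ≤ S := (hf0 _).trans (hS _ ht.2)
  have hn : l ^ 2 ≤ (⌈l ^ 2⌉₊ : ℝ) := Nat.le_ceil _
  have hpow : 1 + (⌈l ^ 2⌉₊ : ℝ) * 3 ≤ A ^ ⌈l ^ 2⌉₊ :=
    calc 1 + (⌈l ^ 2⌉₊ : ℝ) * 3 ≤ (1 + 3) ^ ⌈l ^ 2⌉₊ :=
          one_add_mul_le_pow (by norm_num) _
      _ ≤ A ^ ⌈l ^ 2⌉₊ := by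
          gcongr
          linarith
  have hSA : S ≤ A ^ ⌈l ^ 2⌉₊ * S :=
    le_mul_of_one_le_left hS0 (one_le_pow₀ (by linarith))
  nlinarith [sq_nonneg (l - 1)]
end

section
/- Let f : [0,1] → ℝ be nonnegative and Lipschitz continuous with constant l, and let E ⊆ [0,1] be a Lebesgue-measurable set with mes(E) > 0. Then for every integer n ≥ 1, max_{t ∈ [0,1]} f(t) ≤ (4/mes(E))^n · sup_{t ∈ E} f(t) + (1 + (4/mes(E))^n) · l/(2√n). -/
open MeasureTheory

namespace Polynomial.Chebyshev

/-- The sum of the absolute Lagrange weights of the Chebyshev extremal nodes is the leading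
coefficient of the Chebyshev polynomial. -/
theorem sum_inv_prod_abs_node_sub_node (n : ℕ) :
    ∑ i ∈ Finset.range (n + 1),
      (∏ j ∈ (Finset.range (n + 1)).erase i, |node n i - node n j|)⁻¹ = 2 ^ (n - 1) := by
  have hdeg : (T ℝ n).degree < (Finset.range (n + 1)).card := by
    rw [degree_T, Finset.card_range]
    exact_mod_cast Nat.lt_succ_self n
  have hcoeff := Lagrange.coeff_eq_sum (strictAntiOn_node n).injOn hdeg
  have hlead : (T ℝ n).coeff n = 2 ^ (n - 1) := by
    trans (T ℝ n).leadingCoeff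
    · simp [leadingCoeff]
    · simp
  rw [Finset.card_range, Nat.add_sub_cancel, hlead] at hcoeff
  rw [hcoeff]
  refine Finset.sum_congr rfl fun i hi => ?_
  have hi' : i ≤ n := Nat.lt_succ_iff.mp (Finset.mem_range.mp hi)
  have hpos := zero_lt_prod_node_sub_node hi'
  rw [eval_T_real_node (Finset.mem_Iic.mpr hi'), ← Finset.abs_prod]
  have habs : |∏ j ∈ (Finset.range (n + 1)).erase i, (node n i - node n j)| =
      (-1) ^ i * ∏ j ∈ (Finset.range (n + 1)).erase i, (node n i - node n j) := by
    rw [← abs_of_pos hpos, abs_mul, abs_neg_one_pow, one_mul]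
  rw [habs, mul_inv, ← inv_pow, inv_neg_one, div_eq_mul_inv]

end Polynomial.Chebyshev

theorem volume_real_inter_Iic_sub_le {K : Set ℝ} (hfin : volume K ≠ ⊤)
    {a b : ℝ} (hab : a ≤ b) :
    volume.real (K ∩ Set.Iic b) - volume.real (K ∩ Set.Iic a) ≤ b - a := by
  have hsub : K ∩ Set.Iic b ⊆ (K ∩ Set.Iic a) ∪ Set.Ioc a b := by
    rintro x ⟨hx, hxb⟩
    rcases le_or_gt x a with h | h
    · exact Or.inl ⟨hx, h⟩
    · exact Or.inr ⟨h, hxb⟩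
  have h1 : volume.real (K ∩ Set.Iic b) ≤
      volume.real ((K ∩ Set.Iic a) ∪ Set.Ioc a b) := by
    refine measureReal_mono hsub ?_
    exact measure_union_ne_top (measure_ne_top_of_subset Set.inter_subset_left hfin) (by simp)
  have h2 := measureReal_union_le (μ := volume) (K ∩ Set.Iic a) (Set.Ioc a b)
  have h3 : volume.real (Set.Ioc a b) = b - a := by
    rw [Real.volume_real_Ioc_of_le hab]
  linarith

theorem abs_volume_real_inter_Iic_sub_le {K : Set ℝ}
    (hfin : volume K ≠ ⊤) (a b : ℝ) :
    |volume.real (K ∩ Set.Iic a) - volume.real (K ∩ Set.Iic b)| ≤ |a - b| := by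
  have hmono : ∀ {x y : ℝ}, x ≤ y →
      volume.real (K ∩ Set.Iic x) ≤ volume.real (K ∩ Set.Iic y) := fun h =>
    measureReal_mono (Set.inter_subset_inter_right _ (Set.Iic_subset_Iic.mpr h))
      (measure_ne_top_of_subset Set.inter_subset_left hfin)
  rcases le_total a b with h | h
  · rw [abs_sub_comm, abs_sub_comm a, abs_of_nonneg (sub_nonneg.mpr (hmono h)),
      abs_of_nonneg (sub_nonneg.mpr h)]
    exact volume_real_inter_Iic_sub_le hfin h
  · rw [abs_of_nonneg (sub_nonneg.mpr (hmono h)), abs_of_nonneg (sub_nonneg.mpr h)]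
    exact volume_real_inter_Iic_sub_le hfin h

/-- Every intermediate value of the distribution function of a compact set is attained at a point
of that set. -/
theorem IsCompact.exists_volume_real_inter_Iic_eq {K : Set ℝ} (hK : IsCompact K)
    (hne : K.Nonempty) {c : ℝ} (hc : c ∈ Set.Icc 0 (volume.real K)) :
    ∃ e ∈ K, volume.real (K ∩ Set.Iic e) = c := by
  obtain ⟨a, haK, ha⟩ := hK.exists_isLeast hne
  obtain ⟨b, hbK, hb⟩ := hK.exists_isGreatest hne
  have hfin : volume K ≠ ⊤ := hK.measure_lt_top.ne
  have hφa : volume.real (K ∩ Set.Iic a) = 0 := by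
    have : K ∩ Set.Iic a = {a} := by
      ext x
      exact ⟨fun hx => le_antisymm hx.2 (ha hx.1), by rintro rfl; exact ⟨haK, Set.self_mem_Iic⟩⟩
    simp [this, measureReal_def]
  have hφb : volume.real (K ∩ Set.Iic b) = volume.real K := by
    rw [Set.inter_eq_left.mpr (show K ⊆ Set.Iic b from fun x hx => hb hx)]
  have hcont : Continuous fun x => volume.real (K ∩ Set.Iic x) := by
    refine (LipschitzWith.of_dist_le_mul (K := 1) fun x y => ?_).continuous
    simpa [Real.dist_eq] using abs_volume_real_inter_Iic_sub_le hfin x y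
  obtain ⟨x, hx, hxc⟩ := intermediate_value_Icc (ha hbK) hcont.continuousOn
    (show c ∈ Set.Icc _ _ by rw [hφa, hφb]; exact hc)
  obtain ⟨e, he, hmax⟩ := (hK.inter_right isClosed_Iic).exists_isGreatest
    (⟨a, haK, hx.1⟩ : (K ∩ Set.Iic x).Nonempty)
  refine ⟨e, he.1, ?_⟩
  rw [← hxc]
  congr 1
  ext y
  exact ⟨fun hy => ⟨hy.1, Set.Iic_subset_Iic.mpr he.2 hy.2⟩, fun hy => ⟨hy.1, hmax hy⟩⟩

/-- **Remez-type inequality** on the unit interval, for compact sets. -/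
theorem Polynomial.abs_eval_le_of_isCompact {K : Set ℝ} (hK : IsCompact K)
    (hKsub : K ⊆ Set.Icc 0 1) (hpos : 0 < volume.real K) {n : ℕ} {P : Polynomial ℝ}
    (hP : P.degree ≤ n) {B : ℝ} (hB : ∀ x ∈ K, |P.eval x| ≤ B) {t : ℝ}
    (ht : t ∈ Set.Icc (0 : ℝ) 1) :
    |P.eval t| ≤ (4 / volume.real K) ^ n * B := by
  set M := volume.real K with hM
  have hne : K.Nonempty := by
    by_contra h
    rw [Set.not_nonempty_iff_eq_empty] at h
    simp [hM, h] at hpos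
  have hB0 : 0 ≤ B := (abs_nonneg _).trans (hB _ hne.some_mem)
  have hnodes : ∀ i : ℕ, ∃ e ∈ K,
      volume.real (K ∩ Set.Iic e) = (1 + Chebyshev.node n i) / 2 * M := by
    intro i
    have h := Chebyshev.node_mem_Icc (n := n) (i := i)
    refine hK.exists_volume_real_inter_Iic_eq hne ⟨?_, ?_⟩
    · exact mul_nonneg (by linarith [h.1]) hpos.le
    · exact mul_le_of_le_one_left hpos.le (by linarith [h.2])
  choose e heK he using hnodes
  have hsep : ∀ i j, M / 2 * |Chebyshev.node n i - Chebyshev.node n j| ≤ |e i - e j| := by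
    intro i j
    have h := abs_volume_real_inter_Iic_sub_le hK.measure_lt_top.ne (e i) (e j)
    rw [he, he, show (1 + Chebyshev.node n i) / 2 * M - (1 + Chebyshev.node n j) / 2 * M =
      M / 2 * (Chebyshev.node n i - Chebyshev.node n j) by ring, abs_mul,
      abs_of_pos (half_pos hpos)] at h
    exact h
  have hnode_ne : ∀ i ∈ Finset.range (n + 1), ∀ j ∈ Finset.range (n + 1), i ≠ j →
      0 < |Chebyshev.node n i - Chebyshev.node n j| := fun i hi j hj hij =>
    abs_pos.mpr (sub_ne_zero.mpr ((Chebyshev.strictAntiOn_node n).injOn.ne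
      (Finset.mem_coe.mpr hi) (Finset.mem_coe.mpr hj) hij))
  have hinj : Set.InjOn e (Finset.range (n + 1)) := by
    intro i hi j hj hij
    by_contra hne'
    have h1 := hsep i j
    rw [hij, sub_self, abs_zero] at h1
    exact absurd h1 (not_le.mpr (mul_pos (half_pos hpos) (hnode_ne i hi j hj hne')))
  have hdeg : P.degree < (Finset.range (n + 1)).card := by
    rw [Finset.card_range]
    exact hP.trans_lt (by exact_mod_cast Nat.lt_succ_self n)
  have hinterp := congrArg (Polynomial.eval t) (Lagrange.eq_interpolate hinj hdeg)
  rw [Lagrange.interpolate_eq_sum] at hinterp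
  simp only [eval_finsetSum, eval_mul, eval_C, eval_prod, eval_sub, eval_X] at hinterp
  have hterm : ∀ i ∈ Finset.range (n + 1),
      |P.eval (e i) / (∏ j ∈ (Finset.range (n + 1)).erase i, (e i - e j)) *
        ∏ j ∈ (Finset.range (n + 1)).erase i, (t - e j)| ≤
      B * ((2 / M) ^ n *
        (∏ j ∈ (Finset.range (n + 1)).erase i,
          |Chebyshev.node n i - Chebyshev.node n j|)⁻¹) := by
    intro i hi
    rw [abs_mul, abs_div, Finset.abs_prod, Finset.abs_prod]
    have h1 : ∏ j ∈ (Finset.range (n + 1)).erase i, |t - e j| ≤ 1 := by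
      refine Finset.prod_le_one (fun _ _ => abs_nonneg _) fun j _ => ?_
      have := hKsub (heK j)
      exact abs_le.mpr ⟨by linarith [this.2, ht.1], by linarith [this.1, ht.2]⟩
    have hcard : ((Finset.range (n + 1)).erase i).card = n := by
      rw [Finset.card_erase_of_mem hi, Finset.card_range, Nat.add_sub_cancel]
    have hprod : 0 < ∏ j ∈ (Finset.range (n + 1)).erase i,
        |Chebyshev.node n i - Chebyshev.node n j| :=
      Finset.prod_pos fun j hj => hnode_ne i hi j (Finset.mem_of_mem_erase hj)
        (Finset.ne_of_mem_erase hj).symm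
    have h2 : (M / 2) ^ n * ∏ j ∈ (Finset.range (n + 1)).erase i,
        |Chebyshev.node n i - Chebyshev.node n j| ≤
        ∏ j ∈ (Finset.range (n + 1)).erase i, |e i - e j| := by
      nth_rewrite 1 [← hcard]
      rw [← Finset.prod_const, ← Finset.prod_mul_distrib]
      exact Finset.prod_le_prod (fun j _ => by positivity) fun j _ => hsep i j
    calc _ ≤ |P.eval (e i)| / (∏ j ∈ (Finset.range (n + 1)).erase i, |e i - e j|) * 1 := by
          gcongr
      _ ≤ B / ((M / 2) ^ n * ∏ j ∈ (Finset.range (n + 1)).erase i,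
            |Chebyshev.node n i - Chebyshev.node n j|) := by
          rw [mul_one]
          gcongr
          exact hB _ (heK i)
      _ = _ := by
          rw [div_eq_mul_inv, mul_inv, ← inv_pow, inv_div]
  rw [hinterp]
  calc _ ≤ _ := Finset.abs_sum_le_sum_abs _ _
    _ ≤ _ := Finset.sum_le_sum hterm
    _ = B * ((2 / M) ^ n * 2 ^ (n - 1)) := by
        rw [← Finset.mul_sum, ← Finset.mul_sum, Chebyshev.sum_inv_prod_abs_node_sub_node]
    _ ≤ B * ((2 / M) ^ n * 2 ^ n) := by
        gcongr
        · norm_num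
        · exact Nat.sub_le n 1
    _ = (4 / M) ^ n * B := by
        rw [← mul_pow, mul_comm]
        congr 2
        ring

/-- **Remez-type inequality** on the unit interval. -/
theorem Polynomial.abs_eval_le_of_volume_pos {E : Set ℝ} (hE : E ⊆ Set.Icc 0 1)
    (hpos : 0 < volume.real E) {n : ℕ} {P : Polynomial ℝ} (hP : P.degree ≤ n) {B : ℝ}
    (hB : ∀ x ∈ E, |P.eval x| ≤ B) {t : ℝ} (ht : t ∈ Set.Icc (0 : ℝ) 1) :
    |P.eval t| ≤ (4 / volume.real E) ^ n * B := by
  have hsub : closure E ⊆ Set.Icc 0 1 := closure_minimal hE isClosed_Icc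
  have hK : IsCompact (closure E) := isCompact_Icc.of_isClosed_subset isClosed_closure hsub
  have hle : volume.real E ≤ volume.real (closure E) :=
    measureReal_mono subset_closure hK.measure_lt_top.ne
  have hBK : ∀ x ∈ closure E, |P.eval x| ≤ B := by
    have hclosed : IsClosed {x : ℝ | |P.eval x| ≤ B} :=
      isClosed_le P.continuous.abs continuous_const
    exact closure_minimal hB hclosed
  have hne : E.Nonempty := by
    by_contra h
    rw [Set.not_nonempty_iff_eq_empty] at h
    simp [h] at hpos
  have hB0 : 0 ≤ B := (abs_nonneg _).trans (hB _ hne.some_mem)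
  refine (abs_eval_le_of_isCompact hK hsub (hpos.trans_le hle) hP hBK ht).trans ?_
  gcongr

/-- The Bernstein approximation of degree at most `n` of a function that is Lipschitz on the unit
interval with constant `l` has uniform error at most `l / (2 * √n)`. -/
theorem exists_polynomial_abs_eval_sub_le {f : ℝ → ℝ} {l : ℝ}
    (hlip : ∀ s ∈ Set.Icc (0 : ℝ) 1, ∀ t ∈ Set.Icc (0 : ℝ) 1, |f s - f t| ≤ l * |s - t|)
    {n : ℕ} (hn : n ≠ 0) :
    ∃ P : Polynomial ℝ, P.degree ≤ n ∧
      ∀ t ∈ Set.Icc (0 : ℝ) 1, |P.eval t - f t| ≤ l / (2 * √n) := by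
  have hl : 0 ≤ l := by
    have := hlip 0 (by simp) 1 (by simp)
    norm_num at this
    exact (abs_nonneg _).trans this
  refine ⟨∑ k : Fin (n + 1), Polynomial.C (f (bernstein.z k)) * bernsteinPolynomial ℝ n k,
    ?_, ?_⟩
  · refine (Polynomial.degree_sum_le _ _).trans (Finset.sup_le fun k _ => ?_)
    refine Polynomial.degree_le_of_natDegree_le ((Polynomial.natDegree_C_mul_le _ _).trans ?_)
    rw [bernsteinPolynomial]
    have hk : (k : ℕ) ≤ n := k.is_le
    compute_degree
    omega
  · intro t ht
    lift t to unitInterval using ht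
    have hsqrt : 0 < √(n : ℝ) := Real.sqrt_pos.mpr (by positivity)
    have heval : (∑ k : Fin (n + 1), Polynomial.C (f (bernstein.z k)) *
        bernsteinPolynomial ℝ n k).eval (t : ℝ) =
        ∑ k : Fin (n + 1), f (bernstein.z k) * bernstein n k t := by
      simp only [Polynomial.eval_finsetSum, Polynomial.eval_mul, Polynomial.eval_C]
      rfl
    have hdiff : ∑ k : Fin (n + 1), f (bernstein.z k) * bernstein n k t - f t =
        ∑ k : Fin (n + 1), (f (bernstein.z k) - f t) * bernstein n k t := by
      simp only [sub_mul, Finset.sum_sub_distrib, ← Finset.mul_sum, bernstein.probability,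
        mul_one]
    have hamgm : ∀ d : ℝ, |d| ≤ √n * d ^ 2 + 1 / (4 * √n) := by
      intro d
      have h : √n * d ^ 2 + 1 / (4 * √n) - |d| = (2 * √n * |d| - 1) ^ 2 / (4 * √n) := by
        rw [← sq_abs d]
        field_simp
        ring
      have : 0 ≤ (2 * √n * |d| - 1) ^ 2 / (4 * √n) := by positivity
      linarith
    rw [heval, hdiff]
    calc _ ≤ ∑ k : Fin (n + 1), |(f (bernstein.z k) - f t) * bernstein n k t| :=
          Finset.abs_sum_le_sum_abs _ _
      _ ≤ ∑ k : Fin (n + 1), l * (√n * ((t - bernstein.z k : ℝ) ^ 2 * bernstein n k t) +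
            1 / (4 * √n) * bernstein n k t) := by
          refine Finset.sum_le_sum fun k _ => ?_
          have hb : 0 ≤ bernstein n k t := bernstein_nonneg
          rw [abs_mul, abs_of_nonneg hb]
          have h1 := hlip _ (bernstein.z k).2 _ t.2
          rw [abs_sub_comm (bernstein.z k : ℝ)] at h1
          have h2 := mul_le_mul_of_nonneg_left (hamgm (t - bernstein.z k)) hl
          calc _ ≤ l * (√n * (t - bernstein.z k : ℝ) ^ 2 + 1 / (4 * √n)) * bernstein n k t :=
                mul_le_mul_of_nonneg_right (h1.trans h2) hb
            _ = _ := by ring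
      _ = l * (√n * ((t : ℝ) * (1 - t) / n) + 1 / (4 * √n)) := by
          rw [← Finset.mul_sum, Finset.sum_add_distrib, ← Finset.mul_sum, ← Finset.mul_sum,
            bernstein.variance hn, bernstein.probability, mul_one]
      _ ≤ l * (√n * ((1 / 4) / n) + 1 / (4 * √n)) := by
          gcongr
          nlinarith [sq_nonneg ((t : ℝ) - 1 / 2)]
      _ = l / (2 * √n) := by
          have hsq : √(n : ℝ) ^ 2 = n := Real.sq_sqrt (Nat.cast_nonneg n)
          rw [← hsq, Real.sqrt_sq hsqrt.le]
          field_simp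
          ring

/-- **One-dimensional transfer step.** If `f : [0,1] → ℝ` is nonnegative and Lipschitz with
constant `l`, and `E ⊆ [0,1]` is measurable with positive measure, then for every `n ≥ 1`,
`max_{t ∈ [0,1]} f(t) ≤ (4/mes(E))ⁿ · sup_{t ∈ E} f(t) + (1 + (4/mes(E))ⁿ) · l/(2√n)`. -/
theorem one_dim_transfer (f : ℝ → ℝ) (l : ℝ)
    (hf0 : ∀ t, 0 ≤ f t)
    (hlip : ∀ s ∈ Set.Icc (0:ℝ) 1, ∀ t ∈ Set.Icc (0:ℝ) 1, |f s - f t| ≤ l * |s - t|)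
    (E : Set ℝ) (hEmeas : MeasurableSet E) (hEsub : E ⊆ Set.Icc (0:ℝ) 1)
    (hEpos : 0 < volume E) (n : ℕ) (hn : 1 ≤ n) :
    ∀ t ∈ Set.Icc (0:ℝ) 1,
      f t ≤ (4 / (volume E).toReal) ^ n * (⨆ s : E, f (s : ℝ)) +
        (1 + (4 / (volume E).toReal) ^ n) * l / (2 * Real.sqrt n) := by
  have hfin : volume E ≠ ⊤ := measure_ne_top_of_subset hEsub (by simp)
  have hpos : 0 < volume.real E := ENNReal.toReal_pos hEpos.ne' hfin
  have hbdd : BddAbove (Set.range fun s : E => f s) := by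
    refine ⟨f 0 + |l|, ?_⟩
    rintro _ ⟨⟨s, hs⟩, rfl⟩
    have hs' := hEsub hs
    have h := (le_abs_self _).trans (hlip s hs' 0 (by simp))
    rw [sub_zero, abs_of_nonneg hs'.1] at h
    have h2 : l * s ≤ |l| :=
      (mul_le_mul_of_nonneg_right (le_abs_self l) hs'.1).trans
        (mul_le_of_le_one_right (abs_nonneg l) hs'.2)
    simp only
    linarith
  obtain ⟨P, hPdeg, hP⟩ := exists_polynomial_abs_eval_sub_le hlip (Nat.one_le_iff_ne_zero.mp hn)
  intro t ht
  have hPE : ∀ s ∈ E, |P.eval s| ≤ (⨆ s : E, f (s : ℝ)) + l / (2 * √n) := by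
    intro s hs
    have h1 := abs_sub_abs_le_abs_sub (P.eval s) (f s)
    have h2 := hP s (hEsub hs)
    have h3 : f s ≤ ⨆ s : E, f (s : ℝ) := le_ciSup hbdd ⟨s, hs⟩
    rw [abs_of_nonneg (hf0 s)] at h1
    linarith
  have hremez := (le_abs_self _).trans
    (Polynomial.abs_eval_le_of_volume_pos hEsub hpos hPdeg hPE ht)
  have happrox := (abs_le.mp (hP t ht)).1
  change f t ≤ (4 / volume.real E) ^ n * (⨆ s : E, f (s : ℝ)) +
    (1 + (4 / volume.real E) ^ n) * l / (2 * √n)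
  calc f t ≤ (4 / volume.real E) ^ n * ((⨆ s : E, f (s : ℝ)) + l / (2 * √n)) +
        l / (2 * √n) := by linarith
    _ = _ := by ring
end

section
/- Let I and P be disjoint finite nonempty index sets, let x : I ∪ P → ℝ be attention logits, let d ≥ 1, and let v : I ∪ P → ℝ^d satisfy ‖v_j‖₂ ≤ C_V for all j. Set Z_I = Σ_{i∈I} e^{x_i}, Z_P = Σ_{p∈P} e^{x_p}, y = (1/Z_I)·Σ_{i∈I} e^{x_i} v_i and y' = (1/(Z_I + Z_P))·(Σ_{i∈I} e^{x_i} v_i + Σ_{p∈P} e^{x_p} v_p). Then ‖y' − y‖₂ ≤ 2·C_V·Z_P/(Z_I + Z_P), and consequently ‖y' − y‖₂ ≤ 2·C_V·|P|·e^{x_max}/Z_I, where x_max = max_{p∈P} x_p. -/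
open Finset

/-- A combination of vectors of norm at most `C` with exponential weights has norm at most `C` times
the total weight. -/
theorem norm_sum_exp_smul_le {ι E : Type*} [SeminormedAddCommGroup E] [NormedSpace ℝ E]
    (s : Finset ι) (x : ι → ℝ) (v : ι → E) {C : ℝ} (hv : ∀ j ∈ s, ‖v j‖ ≤ C) :
    ‖∑ j ∈ s, Real.exp (x j) • v j‖ ≤ C * ∑ j ∈ s, Real.exp (x j) := by
  rw [Finset.mul_sum]
  refine norm_sum_le_of_le s fun j hj => ?_
  rw [norm_smul, Real.norm_eq_abs, Real.abs_exp, mul_comm]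
  exact mul_le_mul_of_nonneg_right (hv j hj) (Real.exp_pos _).le

/-- Adding a vector `b` of norm at most `C * q` and mass `q` to an average `a / p` with
`‖a‖ ≤ C * p` moves the average by at most `2 * C * q / (p + q)`. -/
theorem norm_average_add_sub_average_le {E : Type*} [SeminormedAddCommGroup E] [NormedSpace ℝ E]
    {a b : E} {C p q : ℝ} (hp : 0 < p) (hq : 0 < q) (ha : ‖a‖ ≤ C * p) (hb : ‖b‖ ≤ C * q) :
    ‖(1 / (p + q)) • (a + b) - (1 / p) • a‖ ≤ 2 * C * q / (p + q) := by
  have hpq : 0 < p + q := add_pos hp hq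
  have key : (1 / (p + q)) • (a + b) - (1 / p) • a = (1 / (p + q)) • (b - (q / p) • a) := by
    match_scalars <;> field_simp
    ring
  have ha' : ‖(q / p) • a‖ ≤ C * q := by
    rw [norm_smul, Real.norm_of_nonneg (div_pos hq hp).le]
    calc q / p * ‖a‖ ≤ q / p * (C * p) := by gcongr
      _ = C * q := by field_simp
  rw [key, norm_smul, Real.norm_of_nonneg (by positivity), one_div_mul_eq_div]
  gcongr
  linarith [norm_sub_le b ((q / p) • a)]

/-- **Attention stability under padding.** If `y` and `y'` are the softmax attention outputs
before and after inserting the padding tokens `P`, with value vectors bounded by `C_V` in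
`ℓ₂`-norm, then `‖y' − y‖₂ ≤ 2·C_V·Z_P/(Z_I + Z_P)` and consequently
`‖y' − y‖₂ ≤ 2·C_V·|P|·e^{x_max}/Z_I` where `x_max = max_{p∈P} x_p`. -/
theorem attention_padding_stability {ι : Type*} [DecidableEq ι]
    (I P : Finset ι) (hdisj : Disjoint I P) (hI : I.Nonempty) (hP : P.Nonempty)
    (x : ι → ℝ) (d : ℕ) (hd : 1 ≤ d)
    (v : ι → EuclideanSpace ℝ (Fin d)) (CV : ℝ)
    (hv : ∀ j ∈ I ∪ P, ‖v j‖ ≤ CV)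
    (ZI ZP : ℝ)
    (hZI : ZI = ∑ i ∈ I, Real.exp (x i))
    (hZP : ZP = ∑ p ∈ P, Real.exp (x p))
    (y y' : EuclideanSpace ℝ (Fin d))
    (hy : y = (1 / ZI) • ∑ i ∈ I, Real.exp (x i) • v i)
    (hy' : y' = (1 / (ZI + ZP)) •
      ((∑ i ∈ I, Real.exp (x i) • v i) + ∑ p ∈ P, Real.exp (x p) • v p)) :
    ‖y' - y‖ ≤ 2 * CV * ZP / (ZI + ZP) ∧
      ‖y' - y‖ ≤ 2 * CV * P.card * Real.exp (P.sup' hP x) / ZI := by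
  have hZI_pos : 0 < ZI := hZI ▸ Finset.sum_pos (fun i _ => Real.exp_pos _) hI
  have hZP_pos : 0 < ZP := hZP ▸ Finset.sum_pos (fun i _ => Real.exp_pos _) hP
  have hCV : 0 ≤ CV := by
    obtain ⟨i, hi⟩ := hI
    exact (norm_nonneg _).trans (hv i (Finset.mem_union_left P hi))
  have hZP_le : ZP ≤ P.card * Real.exp (P.sup' hP x) := by
    rw [hZP, ← nsmul_eq_mul]
    exact Finset.sum_le_card_nsmul _ _ _ fun p hp =>
      Real.exp_le_exp.mpr (Finset.le_sup' x hp)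
  have main : ‖y' - y‖ ≤ 2 * CV * ZP / (ZI + ZP) := by
    rw [hy, hy']
    refine norm_average_add_sub_average_le hZI_pos hZP_pos ?_ ?_
    · rw [hZI]
      exact norm_sum_exp_smul_le I x v fun j hj => hv j (Finset.mem_union_left P hj)
    · rw [hZP]
      exact norm_sum_exp_smul_le P x v fun j hj => hv j (Finset.mem_union_right I hj)
  refine ⟨main, main.trans ?_⟩
  rw [mul_assoc (2 * CV)]
  gcongr
  linarith
end

section
/- Let T be a finite set with distinguished element t★ ∈ T, c : T → ℝ with c_t > 0, φ_t : ℝ^d → ℝ differentiable for each t, and q_t(i) = c_t·e^{φ_t(i)} / Σ_{s∈T} c_s·e^{φ_s(i)}. Suppose ‖∇φ_t(i)‖₂ ≤ G for all t ∈ T at a point i ∈ ℝ^d. Then for any g : T → [0,1], the function F(i) = Σ_{t∈T} g(t)·q_t(i) satisfies ‖∇F(i)‖₂ ≤ 4·G·Σ_{t≠t★} q_t(i). -/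
open Finset

section Softmax

variable {T E : Type*} [Fintype T] [NormedAddCommGroup E] [NormedSpace ℝ E]

/-- The softmax weight of `t` among the values `φ s`, with prior weights `c s`. -/
noncomputable def softmaxWeight (c φ : T → ℝ) (t : T) : ℝ :=
  c t * Real.exp (φ t) / ∑ s : T, c s * Real.exp (φ s)

theorem softmaxWeight_denom_pos [Nonempty T] {c : T → ℝ} (hc : ∀ t, 0 < c t) (φ : T → ℝ) :
    0 < ∑ s : T, c s * Real.exp (φ s) :=
  Finset.sum_pos (fun s _ => mul_pos (hc s) (Real.exp_pos _)) Finset.univ_nonempty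

theorem softmaxWeight_pos [Nonempty T] {c : T → ℝ} (hc : ∀ t, 0 < c t) (φ : T → ℝ) (t : T) :
    0 < softmaxWeight c φ t :=
  div_pos (mul_pos (hc t) (Real.exp_pos _)) (softmaxWeight_denom_pos hc φ)

theorem sum_softmaxWeight [Nonempty T] {c : T → ℝ} (hc : ∀ t, 0 < c t) (φ : T → ℝ) :
    ∑ t, softmaxWeight c φ t = 1 := by
  simp only [softmaxWeight, ← Finset.sum_div]
  exact div_self (softmaxWeight_denom_pos hc φ).ne'

theorem hasFDerivAt_softmaxWeight [Nonempty T] {c : T → ℝ} (hc : ∀ t, 0 < c t)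
    {φ : T → E → ℝ} {φ' : T → E →L[ℝ] ℝ} {x : E} (hφ : ∀ t, HasFDerivAt (φ t) (φ' t) x) (t : T) :
    HasFDerivAt (fun y => softmaxWeight c (fun s => φ s y) t)
      (softmaxWeight c (fun s => φ s x) t •
        (φ' t - ∑ s, softmaxWeight c (fun r => φ r x) s • φ' s)) x := by
  have hZ := (softmaxWeight_denom_pos hc fun s => φ s x).ne'
  have hw (s : T) := (hφ s).exp.const_mul (c s)
  have hinv := (hasDerivAt_inv hZ).comp_hasFDerivAt x
    (HasFDerivAt.fun_sum (u := Finset.univ) fun s _ => hw s)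
  refine ((hw t).mul hinv).congr_fderiv ?_
  ext v
  simp only [softmaxWeight, div_mul_eq_mul_div, ← Finset.sum_div, smul_apply, add_apply,
    sub_apply, _root_.sum_apply, smul_eq_mul, mul_assoc, Function.comp_apply]
  field_simp
  ring

theorem norm_fderiv_softmaxWeight_le [Nonempty T] {c : T → ℝ} (hc : ∀ t, 0 < c t)
    {φ' : T → E →L[ℝ] ℝ} {G : ℝ} (hG : ∀ t, ‖φ' t‖ ≤ G) (φ : T → ℝ) (t : T) :
    ‖softmaxWeight c φ t • (φ' t - ∑ s, softmaxWeight c φ s • φ' s)‖ ≤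
      2 * G * softmaxWeight c φ t := by
  have hmean : ‖∑ s, softmaxWeight c φ s • φ' s‖ ≤ G := by
    calc ‖∑ s, softmaxWeight c φ s • φ' s‖ ≤ ∑ s, softmaxWeight c φ s * G := by
          refine norm_sum_le_of_le _ fun s _ => ?_
          rw [norm_smul, Real.norm_of_nonneg (softmaxWeight_pos hc φ s).le]
          exact mul_le_mul_of_nonneg_left (hG s) (softmaxWeight_pos hc φ s).le
      _ = G := by rw [← Finset.sum_mul, sum_softmaxWeight hc, one_mul]
  rw [norm_smul, Real.norm_of_nonneg (softmaxWeight_pos hc φ t).le, mul_comm]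
  refine mul_le_mul_of_nonneg_right ?_ (softmaxWeight_pos hc φ t).le
  linarith [norm_sub_le (φ' t) (∑ s, softmaxWeight c φ s • φ' s), hG t]

end Softmax

theorem norm_gradient_eq_norm_fderiv {E : Type*} [NormedAddCommGroup E] [InnerProductSpace ℝ E]
    [CompleteSpace E] (f : E → ℝ) (x : E) : ‖gradient f x‖ = ‖fderiv ℝ f x‖ :=
  LinearIsometryEquiv.norm_map _ _

/-- **Gradient decay of prompt sensitivity (conditional form).** For the softmax posterior
`q_t(i) = c_t·e^{φ_t(i)} / Σ_s c_s·e^{φ_s(i)}` with gradients of the `φ_t` bounded by `G` at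
`i`, and any `g : T → [0,1]`, the posterior predictive `F(i) = Σ_t g(t)·q_t(i)` satisfies
`‖∇F(i)‖₂ ≤ 4·G·Σ_{t≠t★} q_t(i)`. -/
theorem posterior_predictive_gradient_bound
    {T : Type*} [Fintype T] [Nonempty T] [DecidableEq T] (tstar : T) {d : ℕ}
    (c : T → ℝ) (hc : ∀ t, 0 < c t)
    (φ : T → EuclideanSpace ℝ (Fin d) → ℝ) (hφ : ∀ t, Differentiable ℝ (φ t))
    (q : T → EuclideanSpace ℝ (Fin d) → ℝ)
    (hq : ∀ t i, q t i = c t * Real.exp (φ t i) / ∑ s : T, c s * Real.exp (φ s i))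
    (i : EuclideanSpace ℝ (Fin d)) (G : ℝ)
    (hG : ∀ t : T, ‖gradient (φ t) i‖ ≤ G)
    (g : T → ℝ) (hg : ∀ t, g t ∈ Set.Icc (0:ℝ) 1)
    (F : EuclideanSpace ℝ (Fin d) → ℝ)
    (hF : ∀ j, F j = ∑ t : T, g t * q t j) :
    ‖gradient F i‖ ≤ 4 * G * ∑ t ∈ Finset.univ.erase tstar, q t i := by
  obtain rfl : q = fun t j => softmaxWeight c (fun s => φ s j) t :=
    funext fun t => funext fun j => hq t j
  have hF' : F = fun j => g tstar +
      ∑ t ∈ Finset.univ.erase tstar, (g t - g tstar) * softmaxWeight c (fun s => φ s j) t := by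
    funext j
    have h1 := sum_softmaxWeight hc fun s => φ s j
    rw [← Finset.add_sum_erase _ _ (Finset.mem_univ tstar)] at h1
    rw [hF, ← Finset.add_sum_erase _ _ (Finset.mem_univ tstar)]
    simp only [sub_mul, Finset.sum_sub_distrib, ← Finset.mul_sum]
    linear_combination g tstar * h1
  have hder := (HasFDerivAt.fun_sum (u := Finset.univ.erase tstar) fun t _ =>
    (hasFDerivAt_softmaxWeight hc (fun s => (hφ s i).hasFDerivAt) t).const_mul
      (g t - g tstar)).const_add (g tstar)
  rw [← hF'] at hder
  have hG' (t : T) : ‖fderiv ℝ (φ t) i‖ ≤ G := norm_gradient_eq_norm_fderiv (φ t) i ▸ hG t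
  have hG0 : 0 ≤ G := (norm_nonneg _).trans (hG tstar)
  rw [norm_gradient_eq_norm_fderiv, hder.fderiv, Finset.mul_sum]
  refine norm_sum_le_of_le _ fun t _ => ?_
  have hgt : |g t - g tstar| ≤ 1 :=
    abs_sub_le_iff.2 ⟨by linarith [(hg t).2, (hg tstar).1], by linarith [(hg t).1, (hg tstar).2]⟩
  have hq0 := (softmaxWeight_pos hc (fun s => φ s i) t).le
  rw [norm_smul, Real.norm_eq_abs]
  refine (mul_le_of_le_one_left (norm_nonneg _) hgt).trans
    ((norm_fderiv_softmaxWeight_le hc hG' _ t).trans ?_)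
  gcongr
  norm_num
end

section
/- Let p : ℝ^k → ℝ be (the evaluation of) a multivariate real polynomial of total degree at most m, let c ∈ ℝ^k, and let 0 < r ≤ R. Then sup_{‖x−c‖₂ ≤ R} |p(x)| ≤ T_m(R/r) · sup_{‖x−c‖₂ ≤ r} |p(x)|, where T_m is the degree-m Chebyshev polynomial of the first kind. In particular, sup_{‖x−c‖₂ ≤ R} |p(x)| ≤ (2R/r)^m · sup_{‖x−c‖₂ ≤ r} |p(x)|. -/
open Finset

/-- Euclidean (`ℓ₂`) norm on `ℝ^k`. -/
noncomputable def l2norm {k : ℕ} (x : Fin k → ℝ) : ℝ := Real.sqrt (∑ i, (x i) ^ 2)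

open Polynomial in
/-- The extremal growth property of Chebyshev polynomials outside `[-1, 1]`. -/
theorem abs_eval_le_eval_T_mul {m : ℕ} {q : ℝ[X]} {M t : ℝ} (hq : q.natDegree ≤ m)
    (hM : ∀ s ∈ Set.Icc (-1 : ℝ) 1, |q.eval s| ≤ M) (ht : 1 ≤ t) :
    |q.eval t| ≤ (Chebyshev.T ℝ (m : ℤ)).eval t * M := by
  have hM0 : 0 ≤ M := (abs_nonneg _).trans (hM 0 (by simp))
  rcases hM0.eq_or_lt with rfl | hM0
  · have hq0 : q = 0 := q.eq_zero_of_infinite_isRoot <|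
      (Set.Icc_infinite (by norm_num : (-1 : ℝ) < 1)).mono fun s hs ↦
        abs_nonpos_iff.mp (hM s hs)
    simp [hq0]
  have upper {P : ℝ[X]} (hP : P.natDegree ≤ m)
      (hb : ∀ s ∈ Set.Icc (-1 : ℝ) 1, |P.eval s| ≤ M) :
      P.eval t ≤ (Chebyshev.T ℝ (m : ℤ)).eval t * M := by
    have h := Chebyshev.eval_iterate_derivative_le_of_forall_abs_le_one (n := m) (k := 0)
      (P := C M⁻¹ * P) ht
      (natDegree_le_iff_degree_le.mp ((natDegree_C_mul_le _ _).trans hP))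
      (fun s hs ↦ by
        rw [eval_C_mul, abs_mul, abs_of_pos (inv_pos.mpr hM0)]
        exact inv_mul_le_one_of_le₀ (hb s hs) hM0.le)
    simp only [Function.iterate_zero, id_eq, eval_C_mul] at h
    rwa [inv_mul_le_iff₀ hM0, mul_comm] at h
  refine abs_le'.mpr ⟨upper hq hM, ?_⟩
  rw [← eval_neg]
  exact upper (by rwa [natDegree_neg]) (by simpa using hM)

/-- Chebyshev polynomials are dominated by `(2x)ⁿ` to the right of `1`. -/
theorem eval_T_le_two_mul_pow {t : ℝ} (ht : 1 ≤ t) (n : ℕ) :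
    (Polynomial.Chebyshev.T ℝ (n : ℤ)).eval t ≤ (2 * t) ^ n := by
  induction n using Nat.twoStepInduction with
  | zero => simp
  | one => simp; linarith
  | more n _ ih =>
    have h1 := Polynomial.Chebyshev.one_le_eval_T_real n ht
    push_cast at ih ⊢
    rw [Polynomial.Chebyshev.T_add_two, pow_succ']
    simp only [Polynomial.eval_sub, Polynomial.eval_mul, Polynomial.eval_ofNat, Polynomial.eval_X]
    have h2 := mul_le_mul_of_nonneg_left ih (by linarith : 0 ≤ 2 * t)
    linarith

theorem l2norm_smul {k : ℕ} (a : ℝ) (v : Fin k → ℝ) : l2norm (a • v) = |a| * l2norm v := by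
  simp only [l2norm, Pi.smul_apply, smul_eq_mul, mul_pow, ← mul_sum]
  rw [Real.sqrt_mul (sq_nonneg a), Real.sqrt_sq_eq_abs]

theorem abs_apply_le_l2norm {k : ℕ} (v : Fin k → ℝ) (i : Fin k) : |v i| ≤ l2norm v :=
  Real.abs_le_sqrt (single_le_sum (f := fun j ↦ v j ^ 2) (fun _ _ ↦ sq_nonneg _) (mem_univ i))

theorem bddAbove_range_abs_eval_l2ball {k : ℕ} (p : MvPolynomial (Fin k) ℝ) (c : Fin k → ℝ)
    (r : ℝ) :
    BddAbove (Set.range fun y : {y : Fin k → ℝ // l2norm (y - c) ≤ r} ↦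
      |MvPolynomial.eval y.1 p|) := by
  refine ((isCompact_univ_pi fun i ↦ isCompact_closedBall (c i) r).bddAbove_image
    (MvPolynomial.continuous_eval p).abs.continuousOn).mono ?_
  rintro _ ⟨y, rfl⟩
  exact ⟨y.1, fun i _ ↦ (abs_apply_le_l2norm (y.1 - c) i).trans y.2, rfl⟩

open Polynomial in
/-- A multivariate polynomial restricts to a univariate one of no larger degree on a line. -/
theorem exists_polynomial_eval_line {k m : ℕ} (p : MvPolynomial (Fin k) ℝ)
    (hdeg : p.totalDegree ≤ m) (c v : Fin k → ℝ) :
    ∃ q : ℝ[X], q.natDegree ≤ m ∧ ∀ t, q.eval t = MvPolynomial.eval (c + t • v) p := by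
  refine ⟨MvPolynomial.aeval (fun i ↦ C (v i) * X + C (c i)) p, ?_, fun t ↦ ?_⟩
  · simpa using MvPolynomial.aeval_natDegree_le p hdeg _ fun i ↦ natDegree_linear_le
  · rw [← coe_evalRingHom, MvPolynomial.map_aeval, MvPolynomial.eval]
    congr 2
    · ext; simp
    · ext i; simp; ring

/-- **Chebyshev growth on concentric Euclidean balls.** For a multivariate real polynomial `p`
of total degree at most `m`, a center `c` and radii `0 < r ≤ R`,
`sup_{‖x−c‖₂ ≤ R} |p(x)| ≤ T_m(R/r) · sup_{‖x−c‖₂ ≤ r} |p(x)|`, and in particular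
`sup_{‖x−c‖₂ ≤ R} |p(x)| ≤ (2R/r)^m · sup_{‖x−c‖₂ ≤ r} |p(x)|`. -/
theorem chebyshev_growth_balls {k m : ℕ} (p : MvPolynomial (Fin k) ℝ)
    (hdeg : p.totalDegree ≤ m) (c : Fin k → ℝ) (r R : ℝ) (hr : 0 < r) (hrR : r ≤ R) :
    (∀ x : Fin k → ℝ, l2norm (x - c) ≤ R →
      |MvPolynomial.eval x p| ≤ (Polynomial.Chebyshev.T ℝ (m : ℤ)).eval (R / r) *
        ⨆ y : {y : Fin k → ℝ // l2norm (y - c) ≤ r}, |MvPolynomial.eval y.1 p|) ∧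
    (∀ x : Fin k → ℝ, l2norm (x - c) ≤ R →
      |MvPolynomial.eval x p| ≤ (2 * R / r) ^ m *
        ⨆ y : {y : Fin k → ℝ // l2norm (y - c) ≤ r}, |MvPolynomial.eval y.1 p|) := by
  have ht : 1 ≤ R / r := (one_le_div hr).mpr hrR
  have key : ∀ x : Fin k → ℝ, l2norm (x - c) ≤ R →
      |MvPolynomial.eval x p| ≤ (Polynomial.Chebyshev.T ℝ (m : ℤ)).eval (R / r) *
        ⨆ y : {y : Fin k → ℝ // l2norm (y - c) ≤ r}, |MvPolynomial.eval y.1 p| := by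
    intro x hx
    have hR : 0 < R := hr.trans_le hrR
    obtain ⟨q, hq, hqe⟩ := exists_polynomial_eval_line p hdeg c ((r / R) • (x - c))
    have hxe : c + (R / r) • (r / R) • (x - c) = x := by
      rw [smul_smul, div_mul_div_cancel₀ hr.ne', div_self hR.ne', one_smul, add_sub_cancel]
    rw [← congrArg (fun z ↦ MvPolynomial.eval z p) hxe, ← hqe]
    refine abs_eval_le_eval_T_mul hq (fun s hs ↦ ?_) ht
    rw [hqe]
    refine le_ciSup (bddAbove_range_abs_eval_l2ball p c r) ⟨_, ?_⟩
    rw [add_sub_cancel_left, l2norm_smul, l2norm_smul, abs_of_pos (div_pos hr hR)]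
    calc |s| * (r / R * l2norm (x - c)) ≤ 1 * (r / R * R) := by
          gcongr
          · exact mul_nonneg (div_pos hr hR).le (Real.sqrt_nonneg _)
          · exact abs_le.mpr hs
      _ = r := by rw [one_mul, div_mul_cancel₀ _ hR.ne']
  refine ⟨key, fun x hx ↦ (key x hx).trans ?_⟩
  rw [mul_div_assoc]
  exact mul_le_mul_of_nonneg_right (eval_T_le_two_mul_pow ht m)
    (Real.iSup_nonneg fun _ ↦ abs_nonneg _)
end

section
/- Let k ≥ 1, let g : ℝ^k → ℝ be Lipschitz with constant L with respect to the Euclidean norm, let c ∈ ℝ^k, let 0 < r < R, and suppose |g(x)| ≤ δ for all x with ‖x − c‖₂ ≤ r. Then for every integer n ≥ 1, sup_{‖x−c‖₂ ≤ R} |g(x)| ≤ (2R/r)^{nk} · (δ + R·L·√(k/n)) + R·L·√(k/n). -/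
open Finset

theorem l2norm_zero {k : ℕ} : l2norm (0 : Fin k → ℝ) = 0 := by simp [l2norm]

theorem l2norm_one_pos {k : ℕ} (hk : 1 ≤ k) : 0 < l2norm (1 : Fin k → ℝ) := by
  have : (0 : ℝ) < k := by exact_mod_cast hk
  simpa [l2norm] using this

theorem one_le_pow_mul_sqrt_div {a : ℝ} (ha : 2 ≤ a) {n k : ℕ} (hn : 1 ≤ n) (hk : 1 ≤ k) :
    1 ≤ a ^ (n * k) * Real.sqrt (k / n) := by
  have hn' : (1 : ℝ) ≤ n := by exact_mod_cast hn
  have hk' : (1 : ℝ) ≤ k := by exact_mod_cast hk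
  have hpow : (n : ℝ) ≤ a ^ (n * k) :=
    calc (n : ℝ) ≤ 2 ^ n := by exact_mod_cast Nat.lt_two_pow_self.le
      _ ≤ a ^ n := by gcongr
      _ ≤ a ^ (n * k) := pow_le_pow_right₀ (by linarith) (Nat.le_mul_of_pos_right n hk)
  have hsqrt : 1 / (n : ℝ) ≤ Real.sqrt (k / n) := by
    apply Real.le_sqrt_of_sq_le
    calc (1 / (n : ℝ)) ^ 2 = 1 / n / n := by ring
      _ ≤ k / n := by
        gcongr
        exact ((div_le_one (by linarith)).2 hn').trans hk'
  calc (1 : ℝ) = n * (1 / n) := by field_simp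
    _ ≤ a ^ (n * k) * Real.sqrt (k / n) := by gcongr

/-- **Failure-of-convergence bound (abstract core, format 6).** If `g : ℝ^k → ℝ` is
`L`-Lipschitz for the Euclidean norm and `|g| ≤ δ` on the ball of radius `r` about `c`, then
for every `n ≥ 1`, on the ball of radius `R > r`,
`|g(x)| ≤ (2R/r)^{nk}·(δ + R·L·√(k/n)) + R·L·√(k/n)`. -/
theorem outer_ball_bound {k : ℕ} (hk : 1 ≤ k)
    (g : (Fin k → ℝ) → ℝ) (L : ℝ)
    (hLip : ∀ x y : Fin k → ℝ, |g x - g y| ≤ L * l2norm (x - y))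
    (c : Fin k → ℝ) (r R δ : ℝ) (hr : 0 < r) (hrR : r < R)
    (hδ : ∀ x : Fin k → ℝ, l2norm (x - c) ≤ r → |g x| ≤ δ)
    (n : ℕ) (hn : 1 ≤ n) :
    ∀ x : Fin k → ℝ, l2norm (x - c) ≤ R →
      |g x| ≤ (2 * R / r) ^ (n * k) * (δ + R * L * Real.sqrt (k / n)) +
        R * L * Real.sqrt (k / n) := by
  intro x hx
  have hL : 0 ≤ L := by
    have h := (abs_nonneg _).trans (hLip 1 0)
    rw [sub_zero] at h
    exact nonneg_of_mul_nonneg_left h (l2norm_one_pos hk)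
  have hR : 0 < R := hr.trans hrR
  have hgc : |g c| ≤ δ := hδ c (by rw [sub_self, l2norm_zero]; exact hr.le)
  have hδ0 : 0 ≤ δ := (abs_nonneg _).trans hgc
  have hgx : |g x - g c| ≤ R * L := by
    calc |g x - g c| ≤ L * l2norm (x - c) := hLip x c
      _ ≤ L * R := by gcongr
      _ = R * L := mul_comm _ _
  have ha : 2 ≤ 2 * R / r := by
    rw [le_div_iff₀ hr]
    linarith
  have hA : 1 ≤ (2 * R / r) ^ (n * k) := one_le_pow₀ (by linarith)
  have hS := one_le_pow_mul_sqrt_div ha hn hk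
  have hRL : 0 ≤ R * L := mul_nonneg hR.le hL
  have htri : |g x| ≤ |g x - g c| + |g c| := by
    simpa using abs_add_le (g x - g c) (g c)
  have hδA := mul_le_mul_of_nonneg_right hA hδ0
  have hRLS := mul_le_mul_of_nonneg_left hS hRL
  have hlast : 0 ≤ R * L * Real.sqrt (k / n) := mul_nonneg hRL (Real.sqrt_nonneg _)
  linarith
end
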